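/- arXiv:2311.11649 — 5 statements merged into one kernel-verified Lean document; each statement's English description precedes it below -/
import Mathlib

section
/- The map φ defined by φ(((D, δ), E, L), (P, b, S, K)) = (PD, χ(D)⁻¹(b − δ)χ(D), Θ(D)⁻¹ S E, K L) is a right group action of the symmetry group G on the state space M: (i) φ(((I₅, 0), I₄, I₃), ξ) = ξ for all ξ ∈ M; (ii) φ(X, φ(Y, ξ)) = φ(YX, ξ) for all X, Y ∈ G and ξ ∈ M, where YX is the group product of G; and (iii) φ(X, ξ) ∈ M for all X ∈ G, ξ ∈ M. -/
open Matrix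

noncomputable section

abbrev M3 := Matrix (Fin 3) (Fin 3) ℝ
abbrev M4 := Matrix (Fin 4) (Fin 4) ℝ
abbrev M5 := Matrix (Fin 5) (Fin 5) ℝ

/-- The special orthogonal group SO(3) as a set of 3×3 real matrices. -/
def SO3 : Set M3 := {A | A * Aᵀ = 1 ∧ A.det = 1}

/-- Block matrix [[A, a],[0₁ₓ₃, 1]]. -/
def SE3mk (A : M3) (a : Fin 3 → ℝ) : M4 :=
  Matrix.of fun i j =>
    if hi : (i : ℕ) < 3 then
      if hj : (j : ℕ) < 3 then A ⟨i, hi⟩ ⟨j, hj⟩ else a ⟨i, hi⟩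
    else
      if (j : ℕ) < 3 then 0 else 1

/-- SE(3) as a set of 4×4 real matrices. -/
def SE3set : Set M4 := {X | ∃ A a, A ∈ SO3 ∧ X = SE3mk A a}

/-- Block matrix [[A, a, b],[0₂ₓ₃, I₂]]. -/
def SE23mk (A : M3) (a b : Fin 3 → ℝ) : M5 :=
  Matrix.of fun i j =>
    if hi : (i : ℕ) < 3 then
      if hj : (j : ℕ) < 3 then A ⟨i, hi⟩ ⟨j, hj⟩
      else if (j : ℕ) = 3 then a ⟨i, hi⟩ else b ⟨i, hi⟩
    else
      if i = j then 1 else 0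

/-- SE₂(3) as a set of 5×5 real matrices. -/
def SE23set : Set M5 := {P | ∃ A a b, A ∈ SO3 ∧ P = SE23mk A a b}

/-- Block matrix [[Ω, v],[0₁ₓ₃, 0]]. -/
def se3mk (Ω : M3) (v : Fin 3 → ℝ) : M4 :=
  Matrix.of fun i j =>
    if hi : (i : ℕ) < 3 then
      if hj : (j : ℕ) < 3 then Ω ⟨i, hi⟩ ⟨j, hj⟩ else v ⟨i, hi⟩
    else 0

/-- The Lie algebra se(3) as a set of 4×4 real matrices. -/
def se3set : Set M4 := {u | ∃ Ω v, Ωᵀ = -Ω ∧ u = se3mk Ω v}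

/-- Block matrix [[Ω, v, w],[0₂ₓ₃, 0₂ₓ₂]]. -/
def se23mkAlg (Ω : M3) (v w : Fin 3 → ℝ) : M5 :=
  Matrix.of fun i j =>
    if hi : (i : ℕ) < 3 then
      if hj : (j : ℕ) < 3 then Ω ⟨i, hi⟩ ⟨j, hj⟩
      else if (j : ℕ) = 3 then v ⟨i, hi⟩ else w ⟨i, hi⟩
    else 0

/-- The Lie algebra se₂(3) as a set of 5×5 real matrices. -/
def se23set : Set M5 := {u | ∃ Ω v w, Ωᵀ = -Ω ∧ u = se23mkAlg Ω v w}

/-- Camera intrinsics matrix [[a, 0, x],[0, b, y],[0, 0, 1]]. -/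
def INmk (a b x y : ℝ) : M3 := !![a, 0, x; 0, b, y; 0, 0, 1]

/-- The intrinsics group IN as a set of 3×3 real matrices. -/
def INset : Set M3 := {K | ∃ a b x y : ℝ, 0 < a ∧ 0 < b ∧ K = INmk a b x y}

/-- χ : SE₂(3) → SE(3), [[A, a, b],[0₂ₓ₃, I₂]] ↦ [[A, a],[0₁ₓ₃, 1]]. -/
def chi (D : M5) : M4 :=
  Matrix.of fun i j =>
    if (i : ℕ) < 3 then
      if (j : ℕ) < 3 then D (Fin.castSucc i) (Fin.castSucc j) else D (Fin.castSucc i) 3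
    else
      if (j : ℕ) < 3 then 0 else 1

/-- Θ : SE₂(3) → SE(3), [[A, a, b],[0₂ₓ₃, I₂]] ↦ [[A, b],[0₁ₓ₃, 1]]. -/
def Theta (D : M5) : M4 :=
  Matrix.of fun i j =>
    if (i : ℕ) < 3 then
      if (j : ℕ) < 3 then D (Fin.castSucc i) (Fin.castSucc j) else D (Fin.castSucc i) 4
    else
      if (j : ℕ) < 3 then 0 else 1

/-- The skew-symmetric matrix ω^∧ with ω^∧ x = ω × x. -/
def wedge (ω : Fin 3 → ℝ) : M3 :=
  !![0, -ω 2, ω 1; ω 2, 0, -ω 0; -ω 1, ω 0, 0]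

/-- The input matrix W = [[ω^∧, a, 0],[0₂ₓ₃, 0₂ₓ₂]]. -/
def Wmat (ω a : Fin 3 → ℝ) : M5 := se23mkAlg (wedge ω) a 0

/-- The drift matrix D: only nonzero entry is a 1 in position (4,5) (1-indexed). -/
def Dmat : M5 := Matrix.of fun i j => if (i : ℕ) = 3 ∧ (j : ℕ) = 4 then 1 else 0

/-- The gravity matrix G: only nonzero entries are g·e₃ in rows 1–3 of column 4 (1-indexed). -/
def Gmat (g : ℝ) : M5 := Matrix.of fun i j => if (i : ℕ) = 2 ∧ (j : ℕ) = 3 then g else 0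

/-- The direction of gravity e₃ = (0,0,1). -/
def e3 : Fin 3 → ℝ := ![0, 0, 1]

/-- Elements of the symmetry group G = (SE₂(3) ⋉ se(3)) × SE(3) × IN. -/
abbrev GT := (M5 × M4) × M4 × M3

/-- Elements of the state space M = SE₂(3) × se(3) × SE(3) × IN. -/
abbrev MT := M5 × M4 × M4 × M3

/-- The symmetry group G as a subset of GT. -/
def Gset : Set GT := {X | X.1.1 ∈ SE23set ∧ X.1.2 ∈ se3set ∧ X.2.1 ∈ SE3set ∧ X.2.2 ∈ INset}

/-- The state space M as a subset of MT. -/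
def Mset : Set MT := {ξ | ξ.1 ∈ SE23set ∧ ξ.2.1 ∈ se3set ∧ ξ.2.2.1 ∈ SE3set ∧ ξ.2.2.2 ∈ INset}

/-- Group product on G. -/
def gMul (X Y : GT) : GT :=
  ((X.1.1 * Y.1.1, X.1.2 + chi X.1.1 * Y.1.2 * (chi X.1.1)⁻¹), X.2.1 * Y.2.1, X.2.2 * Y.2.2)

/-- Identity element of G. -/
def gOne : GT := ((1, 0), 1, 1)

/-- The group action φ of G on M. -/
def phi (X : GT) (ξ : MT) : MT :=
  (ξ.1 * X.1.1, (chi X.1.1)⁻¹ * (ξ.2.1 - X.1.2) * chi X.1.1,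
   (Theta X.1.1)⁻¹ * ξ.2.2.1 * X.2.1, ξ.2.2.2 * X.2.2)

/-- The reference-frame change action α(H, (P, b, S, K)) = (H⁻¹P, b, S, K). -/
def alphaAct (H : M5) (ξ : MT) : MT := (H⁻¹ * ξ.1, ξ.2)

theorem SE3mk_mul (A B : M3) (a b : Fin 3 → ℝ) :
    SE3mk A a * SE3mk B b = SE3mk (A * B) (A *ᵥ b + a) := by
  ext i j
  fin_cases i <;> fin_cases j <;>
    simp [SE3mk, Matrix.mul_apply, Fin.sum_univ_succ, Matrix.mulVec, dotProduct] <;> ring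

theorem SE23mk_mul (A B : M3) (a b c d : Fin 3 → ℝ) :
    SE23mk A a b * SE23mk B c d = SE23mk (A * B) (A *ᵥ c + a) (A *ᵥ d + b) := by
  ext i j
  fin_cases i <;> fin_cases j <;>
    simp [SE23mk, Matrix.mul_apply, Fin.sum_univ_succ, Matrix.mulVec, dotProduct] <;> ring

theorem SE3mk_mul_se3mk (A B : M3) (a b : Fin 3 → ℝ) :
    SE3mk A a * se3mk B b = se3mk (A * B) (A *ᵥ b) := by
  ext i j
  fin_cases i <;> fin_cases j <;>
    simp [SE3mk, se3mk, Matrix.mul_apply, Fin.sum_univ_succ, Matrix.mulVec, dotProduct]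

theorem se3mk_mul_SE3mk (A B : M3) (a b : Fin 3 → ℝ) :
    se3mk A a * SE3mk B b = se3mk (A * B) (A *ᵥ b + a) := by
  ext i j
  fin_cases i <;> fin_cases j <;>
    simp [SE3mk, se3mk, Matrix.mul_apply, Fin.sum_univ_succ, Matrix.mulVec, dotProduct] <;> ring

theorem se3mk_sub (A B : M3) (a b : Fin 3 → ℝ) :
    se3mk A a - se3mk B b = se3mk (A - B) (a - b) := by
  ext i j
  fin_cases i <;> fin_cases j <;> simp [se3mk]

theorem SE3mk_one : SE3mk 1 0 = 1 := by
  ext i j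
  fin_cases i <;> fin_cases j <;> simp [SE3mk, Matrix.one_apply]

theorem SE23mk_one : SE23mk 1 0 0 = 1 := by
  ext i j
  fin_cases i <;> fin_cases j <;> simp [SE23mk, Matrix.one_apply]

theorem chi_mk (A : M3) (a b : Fin 3 → ℝ) : chi (SE23mk A a b) = SE3mk A a := by
  ext i j
  fin_cases i <;> fin_cases j <;> simp [SE23mk, SE3mk, chi]

theorem Theta_mk (A : M3) (a b : Fin 3 → ℝ) : Theta (SE23mk A a b) = SE3mk A b := by
  ext i j
  fin_cases i <;> fin_cases j <;> simp [SE23mk, SE3mk, Theta]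

theorem SE3mk_mul_inv {A : M3} (hA : A ∈ SO3) (a : Fin 3 → ℝ) :
    SE3mk A a * SE3mk Aᵀ (-(Aᵀ *ᵥ a)) = 1 := by
  rw [SE3mk_mul, hA.1, Matrix.mulVec_neg, Matrix.mulVec_mulVec, hA.1, ← SE3mk_one]
  simp

theorem SE3mk_inv {A : M3} (hA : A ∈ SO3) (a : Fin 3 → ℝ) :
    (SE3mk A a)⁻¹ = SE3mk Aᵀ (-(Aᵀ *ᵥ a)) :=
  Matrix.inv_eq_right_inv (SE3mk_mul_inv hA a)

theorem SO3_mul {A B : M3} (hA : A ∈ SO3) (hB : B ∈ SO3) : A * B ∈ SO3 := by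
  refine ⟨?_, by rw [Matrix.det_mul, hA.2, hB.2, one_mul]⟩
  rw [Matrix.transpose_mul, Matrix.mul_assoc, ← Matrix.mul_assoc B, hB.1, Matrix.one_mul, hA.1]

theorem SO3_transpose {A : M3} (hA : A ∈ SO3) : Aᵀ ∈ SO3 := by
  refine ⟨?_, by rw [Matrix.det_transpose, hA.2]⟩
  rw [Matrix.transpose_transpose]
  exact mul_eq_one_comm.mp hA.1

theorem INmk_mul (a b x y c d z w : ℝ) :
    INmk a b x y * INmk c d z w = INmk (a * c) (b * d) (a * z + x) (b * w + y) := by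
  ext i j
  fin_cases i <;> fin_cases j <;> simp [INmk, Matrix.mul_apply, Fin.sum_univ_succ]

theorem chi_mul {P Q : M5} (hP : P ∈ SE23set) (hQ : Q ∈ SE23set) :
    chi (P * Q) = chi P * chi Q := by
  obtain ⟨A, a, b, -, rfl⟩ := hP
  obtain ⟨B, c, d, -, rfl⟩ := hQ
  simp only [SE23mk_mul, chi_mk, SE3mk_mul]

theorem Theta_mul {P Q : M5} (hP : P ∈ SE23set) (hQ : Q ∈ SE23set) :
    Theta (P * Q) = Theta P * Theta Q := by
  obtain ⟨A, a, b, -, rfl⟩ := hP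
  obtain ⟨B, c, d, -, rfl⟩ := hQ
  simp only [SE23mk_mul, Theta_mk, SE3mk_mul]

theorem chi_inv_mul {P : M5} (hP : P ∈ SE23set) : (chi P)⁻¹ * chi P = 1 := by
  obtain ⟨A, a, b, hA, rfl⟩ := hP
  rw [chi_mk, SE3mk_inv hA]
  exact mul_eq_one_comm.mp (SE3mk_mul_inv hA a)

/-- φ is a right group action of the symmetry group G on the state space M. -/
theorem stmt9 :
    (∀ ξ ∈ Mset, phi gOne ξ = ξ) ∧
    (∀ X ∈ Gset, ∀ Y ∈ Gset, ∀ ξ ∈ Mset, phi X (phi Y ξ) = phi (gMul Y X) ξ) ∧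
    (∀ X ∈ Gset, ∀ ξ ∈ Mset, phi X ξ ∈ Mset) := by
  refine ⟨?_, ?_, ?_⟩
  · rintro ⟨P, b, S, K⟩ -
    have h1 : chi 1 = 1 := by rw [← SE23mk_one, chi_mk, SE3mk_one]
    have h2 : Theta 1 = 1 := by rw [← SE23mk_one, Theta_mk, SE3mk_one]
    simp [phi, gOne, h1, h2]
  · rintro ⟨⟨D, δ⟩, E, L⟩ ⟨hD, -, -, -⟩ ⟨⟨D', δ'⟩, E', L'⟩ ⟨hD', -, -, -⟩ ⟨P, b, S, K⟩ -
    dsimp only at hD hD'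
    have hc := chi_inv_mul hD'
    simp only [phi, gMul, chi_mul hD' hD, Theta_mul hD' hD, Matrix.mul_inv_rev, Prod.mk.injEq]
    refine ⟨Matrix.mul_assoc _ _ _, ?_, by simp only [Matrix.mul_assoc],
      Matrix.mul_assoc _ _ _⟩
    generalize chi D' = U at *
    generalize chi D = V at *
    have key : U⁻¹ * (b - (δ' + U * δ * U⁻¹)) * U = U⁻¹ * (b - δ') * U - δ := by
      have : U⁻¹ * (b - (δ' + U * δ * U⁻¹)) * U
          = U⁻¹ * (b - δ') * U - (U⁻¹ * U) * δ * (U⁻¹ * U) := by noncomm_ring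
      rw [this, hc, Matrix.one_mul, Matrix.mul_one]
    rw [← key]
    simp only [Matrix.mul_assoc]
  · rintro ⟨⟨D, δ⟩, E, L⟩ ⟨⟨A, a, a', hA, rfl⟩, ⟨Ω, v, hΩ, rfl⟩, ⟨B, c, hB, rfl⟩,
      ⟨l1, l2, l3, l4, hl1, hl2, rfl⟩⟩ ⟨P, b, S, K⟩ ⟨⟨A', p, p', hA', rfl⟩,
      ⟨Ω', v', hΩ', rfl⟩, ⟨B', c', hB', rfl⟩, ⟨k1, k2, k3, k4, hk1, hk2, rfl⟩⟩
    refine ⟨?_, ?_, ?_, ?_⟩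
    · simp only [phi, SE23mk_mul]
      exact ⟨_, _, _, SO3_mul hA' hA, rfl⟩
    · simp only [phi, chi_mk, SE3mk_inv hA, se3mk_sub, SE3mk_mul_se3mk, se3mk_mul_SE3mk]
      refine ⟨_, _, ?_, rfl⟩
      simp only [Matrix.transpose_mul, Matrix.transpose_sub, Matrix.transpose_transpose, hΩ, hΩ']
      noncomm_ring
    · simp only [phi, Theta_mk, SE3mk_inv hA, SE3mk_mul]
      exact ⟨_, _, SO3_mul (SO3_mul (SO3_transpose hA) hB') hB, rfl⟩
    · simp only [phi, INmk_mul]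
      exact ⟨_, _, _, _, mul_pos hk1 hl1, mul_pos hk2 hl2, rfl⟩
end
end

section
/- The group action φ is transitive: for every pair of states ξ₁ = (P₁, b₁, S₁, K₁) and ξ₂ = (P₂, b₂, S₂, K₂) in M there exists X = ((D, δ), E, L) in the symmetry group G such that φ(X, ξ₁) = ξ₂. -/
open Matrix

noncomputable section

theorem SE3_inv {C : M4} (hC : C ∈ SE3set) : C⁻¹ ∈ SE3set ∧ C * C⁻¹ = 1 ∧ C⁻¹ * C = 1 := by
  obtain ⟨A, a, hA, rfl⟩ := hC
  have h := SE3mk_mul_inv hA a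
  rw [Matrix.inv_eq_right_inv h]
  exact ⟨⟨_, _, SO3_transpose hA, rfl⟩, h, mul_eq_one_comm.mp h⟩

theorem SE3_mul {C D : M4} (hC : C ∈ SE3set) (hD : D ∈ SE3set) : C * D ∈ SE3set := by
  obtain ⟨A, a, hA, rfl⟩ := hC
  obtain ⟨B, b, hB, rfl⟩ := hD
  exact ⟨_, _, SO3_mul hA hB, SE3mk_mul _ _ _ _⟩

theorem se3_conj {C u : M4} (hC : C ∈ SE3set) (hu : u ∈ se3set) : C * u * C⁻¹ ∈ se3set := by
  obtain ⟨A, a, hA, rfl⟩ := hC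
  obtain ⟨B, b, hB, rfl⟩ := hu
  rw [Matrix.inv_eq_right_inv (SE3mk_mul_inv hA a), SE3mk_mul_se3mk, se3mk_mul_SE3mk]
  refine ⟨_, _, ?_, rfl⟩
  simp [Matrix.transpose_mul, hB, Matrix.mul_assoc]

theorem se3_sub {u v : M4} (hu : u ∈ se3set) (hv : v ∈ se3set) : u - v ∈ se3set := by
  obtain ⟨A, a, hA, rfl⟩ := hu
  obtain ⟨B, b, hB, rfl⟩ := hv
  refine ⟨_, _, ?_, se3mk_sub _ _ _ _⟩
  rw [Matrix.transpose_sub, hA, hB]; abel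

theorem SE23_div {P Q : M5} (hP : P ∈ SE23set) (hQ : Q ∈ SE23set) :
    ∃ D ∈ SE23set, P * D = Q := by
  obtain ⟨A, a, b, hA, rfl⟩ := hP
  obtain ⟨B, c, d, hB, rfl⟩ := hQ
  refine ⟨SE23mk (Aᵀ * B) (Aᵀ *ᵥ (c - a)) (Aᵀ *ᵥ (d - b)),
    ⟨_, _, _, SO3_mul (SO3_transpose hA) hB, rfl⟩, ?_⟩
  rw [SE23mk_mul, ← Matrix.mul_assoc, hA.1, Matrix.mulVec_mulVec, Matrix.mulVec_mulVec, hA.1]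
  simp

theorem IN_div {K L : M3} (hK : K ∈ INset) (hL : L ∈ INset) : ∃ N ∈ INset, K * N = L := by
  obtain ⟨a, b, x, y, ha, hb, rfl⟩ := hK
  obtain ⟨c, d, z, w, hc, hd, rfl⟩ := hL
  refine ⟨INmk (c / a) (d / b) ((z - x) / a) ((w - y) / b),
    ⟨_, _, _, _, div_pos hc ha, div_pos hd hb, rfl⟩, ?_⟩
  have ha' := ha.ne'
  have hb' := hb.ne'
  ext i j
  fin_cases i <;> fin_cases j <;>
    simp [INmk, Matrix.mul_apply, Fin.sum_univ_succ] <;> field_simp <;> ring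

/-- the group action φ is transitive on M. -/
theorem stmt10 (ξ₁ ξ₂ : MT) (h₁ : ξ₁ ∈ Mset) (h₂ : ξ₂ ∈ Mset) :
    ∃ X ∈ Gset, phi X ξ₁ = ξ₂ := by
  obtain ⟨P, b, S, K⟩ := ξ₁
  obtain ⟨P', b', S', K'⟩ := ξ₂
  obtain ⟨hP, hb, hS, hK⟩ := h₁
  obtain ⟨hP', hb', hS', hK'⟩ := h₂
  dsimp only at hP hb hS hK hP' hb' hS' hK'
  obtain ⟨D, hD, hPD⟩ := SE23_div hP hP'
  obtain ⟨L, hL, hKL⟩ := IN_div hK hK'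
  have hC : chi D ∈ SE3set := by
    obtain ⟨A, a, c, hA, rfl⟩ := hD
    exact ⟨_, _, hA, chi_mk _ _ _⟩
  have hT : Theta D ∈ SE3set := by
    obtain ⟨A, a, c, hA, rfl⟩ := hD
    exact ⟨_, _, hA, Theta_mk _ _ _⟩
  obtain ⟨-, hC1, hC2⟩ := SE3_inv hC
  obtain ⟨-, hT1, hT2⟩ := SE3_inv hT
  obtain ⟨hSi, hS1, hS2⟩ := SE3_inv hS
  refine ⟨((D, b - chi D * b' * (chi D)⁻¹), S⁻¹ * (Theta D * S'), L),
    ⟨hD, se3_sub hb (se3_conj hC hb'), SE3_mul hSi (SE3_mul hT hS'), hL⟩, ?_⟩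
  have e1 : (chi D)⁻¹ * (b - (b - chi D * b' * (chi D)⁻¹)) * chi D = b' := by
    rw [sub_sub_cancel]
    calc _ = ((chi D)⁻¹ * chi D) * b' * ((chi D)⁻¹ * chi D) := by simp only [Matrix.mul_assoc]
      _ = b' := by rw [hC2, Matrix.one_mul, Matrix.mul_one]
  have e2 : (Theta D)⁻¹ * S * (S⁻¹ * (Theta D * S')) = S' := by
    calc _ = (Theta D)⁻¹ * (S * S⁻¹) * Theta D * S' := by simp only [Matrix.mul_assoc]
      _ = S' := by rw [hS1, Matrix.mul_one, hT2, Matrix.one_mul]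
  simp only [phi, hPD, hKL, e1, e2]
end
end

section
/- The first component of the lift is well defined in se₂(3): for every P ∈ SE₂(3) and all ω, a, b_ω, b_a ∈ ℝ³, the 5×5 matrix Λ₁ = (W − B + D) + P⁻¹(G − D)P belongs to se₂(3). -/
open Matrix

noncomputable section

theorem helper_inv (A : M3) (p q : Fin 3 → ℝ) (h : Aᵀ * A = 1) :
    (SE23mk A p q)⁻¹ = SE23mk Aᵀ (-(Aᵀ *ᵥ p)) (-(Aᵀ *ᵥ q)) := by
  apply Matrix.inv_eq_left_inv
  have hh : ∀ i j, A 0 i * A 0 j + A 1 i * A 1 j + A 2 i * A 2 j = (1 : M3) i j := by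
    intro i j
    rw [← h]
    simp [Matrix.mul_apply, Fin.sum_univ_three]
  ext i j
  fin_cases i <;> fin_cases j <;>
    simp [SE23mk, Matrix.mul_apply, Fin.sum_univ_succ, Matrix.mulVec, dotProduct] <;>
    first
    | (ring; done)
    | (have h1 := hh 0 0; simp at h1; linarith)
    | (have h1 := hh 0 1; simp at h1; linarith)
    | (have h1 := hh 0 2; simp at h1; linarith)
    | (have h1 := hh 1 1; simp at h1; linarith)
    | (have h1 := hh 1 2; simp at h1; linarith)
    | (have h1 := hh 2 2; simp at h1; linarith)

theorem helper_right (g : ℝ) (A : M3) (p q : Fin 3 → ℝ) :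
    (Gmat g - Dmat) * SE23mk A p q = Gmat g - Dmat := by
  ext i j
  fin_cases i <;> fin_cases j <;>
    simp [SE23mk, Gmat, Dmat, Matrix.mul_apply, Fin.sum_univ_succ]

/-- the first lift component Λ₁ = (W − B + D) + P⁻¹(G − D)P lies in se₂(3). -/
theorem stmt12 (g : ℝ) (ω a bω ba : Fin 3 → ℝ) (P : M5) (hP : P ∈ SE23set) :
    (Wmat ω a - Wmat bω ba + Dmat) + P⁻¹ * (Gmat g - Dmat) * P ∈ se23set := by
  obtain ⟨A, p, q, ⟨hA, -⟩, rfl⟩ := hP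
  rw [helper_inv A p q (mul_eq_one_comm.mp hA), Matrix.mul_assoc, helper_right]
  refine ⟨wedge ω - wedge bω, a - ba + g • (fun i => A 2 i), Aᵀ *ᵥ p, ?_, ?_⟩
  · ext i j
    fin_cases i <;> fin_cases j <;> simp [wedge] <;> ring
  · ext i j
    fin_cases i <;> fin_cases j <;>
      simp [SE23mk, se23mkAlg, Wmat, Gmat, Dmat, Matrix.mul_apply, Fin.sum_univ_succ] <;> ring
end
end

section
/- Let H = [[R_H, 0, p_H],[0₂ₓ₃, I₂]] ∈ SE₂(3) with R_H ∈ SO(3) satisfying R_H e₃ = e₃ and p_H ∈ ℝ³ (a rotation about the vertical axis composed with a translation, with zero velocity component). Then H(G − D)H⁻¹ = G − D. -/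
open Matrix

noncomputable section

/-- H(G − D)H⁻¹ = G − D for H = [[R_H, 0, p_H],[0₂ₓ₃, I₂]] with
R_H ∈ SO(3), R_H e₃ = e₃. -/
theorem stmt13 (g : ℝ) (R : M3) (p : Fin 3 → ℝ) (hR : R ∈ SO3) (he : R *ᵥ e3 = e3) :
    SE23mk R 0 p * (Gmat g - Dmat) * (SE23mk R 0 p)⁻¹ = Gmat g - Dmat := by
  obtain ⟨hRR, -⟩ := hR
  have hc : SE23mk R 0 p * (Gmat g - Dmat) = (Gmat g - Dmat) * SE23mk R 0 p := by
    have h0 := congrFun he 0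
    have h1 := congrFun he 1
    have h2 := congrFun he 2
    simp [e3, Matrix.mulVec, dotProduct, Fin.sum_univ_succ] at h0 h1 h2
    ext i j
    fin_cases i <;> fin_cases j <;>
      simp [SE23mk, Gmat, Dmat, Matrix.mul_apply, Fin.sum_univ_succ, h0, h1, h2]
  have hi : SE23mk R 0 p * SE23mk Rᵀ 0 (-(Rᵀ *ᵥ p)) = 1 := by
    have hp : R *ᵥ (Rᵀ *ᵥ p) = p := by rw [Matrix.mulVec_mulVec, hRR, Matrix.one_mulVec]
    have hq : ∀ i, ∑ k, R i k * (Rᵀ *ᵥ p) k = p i := fun i => congrFun hp i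
    have hr : ∀ i j, ∑ k, R i k * R j k = (1 : M3) i j := fun i j => by
      rw [← hRR, Matrix.mul_apply]; rfl
    generalize Rᵀ *ᵥ p = q at hq
    simp only [Fin.sum_univ_three] at hq hr
    ext i j
    rw [Matrix.mul_apply, Fin.sum_univ_five]
    fin_cases i <;> fin_cases j <;>
      first
      | (simp [SE23mk]; done)
      | (simp [SE23mk]; linarith [hq 0, hq 1, hq 2])
      | (simpa [SE23mk] using hr 0 0)
      | (simpa [SE23mk] using hr 0 1)
      | (simpa [SE23mk] using hr 0 2)
      | (simpa [SE23mk] using hr 1 0)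
      | (simpa [SE23mk] using hr 1 1)
      | (simpa [SE23mk] using hr 1 2)
      | (simpa [SE23mk] using hr 2 0)
      | (simpa [SE23mk] using hr 2 1)
      | (simpa [SE23mk] using hr 2 2)
  rw [hc, Matrix.mul_assoc, Matrix.mul_nonsing_inv _ (Matrix.isUnit_det_of_right_inverse hi),
    Matrix.mul_one]
end
end

section
/- The first lift component is invariant under changes of reference frame: for every H = [[R_H, 0, p_H],[0₂ₓ₃, I₂]] ∈ SE₂(3) with R_H ∈ SO(3), R_H e₃ = e₃, p_H ∈ ℝ³, and every P ∈ SE₂(3), one has (W − B + D) + (H⁻¹P)⁻¹(G − D)(H⁻¹P) = (W − B + D) + P⁻¹(G − D)P, for all ω, a, b_ω, b_a ∈ ℝ³. -/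
open Matrix

noncomputable section

lemma aux_inv (R : M3) (p : Fin 3 → ℝ) (hR : R ∈ SO3) :
    SE23mk R 0 p * SE23mk Rᵀ 0 (-(Rᵀ *ᵥ p)) = 1 := by
  have h1 : R * Rᵀ = 1 := hR.1
  have h2 : R *ᵥ (Rᵀ *ᵥ p) = p := by rw [Matrix.mulVec_mulVec, h1, Matrix.one_mulVec]
  have e1 : ∀ i j : Fin 3, (R * Rᵀ) i j = (1 : M3) i j := fun i j => by rw [h1]
  have e2 : ∀ i : Fin 3, (R *ᵥ (Rᵀ *ᵥ p)) i = p i := fun i => by rw [h2]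
  have hsplit : ∀ i j, (SE23mk R 0 p * SE23mk Rᵀ 0 (-(Rᵀ *ᵥ p))) i j = (1 : M5) i j := by
    generalize hq : Rᵀ *ᵥ p = q at *
    intro i j
    have f1 := fun i j => e1 i j
    simp only [Matrix.mul_apply, Fin.sum_univ_three, Matrix.transpose_apply, Matrix.one_apply] at f1
    simp only [Matrix.mulVec, dotProduct, Fin.sum_univ_three] at e2
    rw [Matrix.mul_apply, Fin.sum_univ_five]
    fin_cases i <;> fin_cases j <;>
      first
      | (simp [SE23mk]; done)
      | (simp [SE23mk]
         first
         | linarith [e2 0, e2 1, e2 2]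
         | simpa using f1 0 0
         | simpa using f1 0 1
         | simpa using f1 0 2
         | simpa using f1 1 0
         | simpa using f1 1 1
         | simpa using f1 1 2
         | simpa using f1 2 0
         | simpa using f1 2 1
         | simpa using f1 2 2)
  exact Matrix.ext hsplit

lemma aux_comm (g : ℝ) (R : M3) (p : Fin 3 → ℝ) (he : R *ᵥ e3 = e3) :
    SE23mk R 0 p * (Gmat g - Dmat) = (Gmat g - Dmat) * SE23mk R 0 p := by
  have h0 : R 0 2 = 0 := by simpa [Matrix.mulVec, dotProduct, Fin.sum_univ_three, e3] using congrFun he 0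
  have h1 : R 1 2 = 0 := by simpa [Matrix.mulVec, dotProduct, Fin.sum_univ_three, e3] using congrFun he 1
  have h2 : R 2 2 = 1 := by simpa [Matrix.mulVec, dotProduct, Fin.sum_univ_three, e3] using congrFun he 2
  ext i j
  rw [Matrix.mul_apply, Matrix.mul_apply, Fin.sum_univ_five, Fin.sum_univ_five]
  fin_cases i <;> fin_cases j <;> simp [SE23mk, Gmat, Dmat, h0, h1, h2]

/-- the first lift component is invariant under changes of reference frame. -/
theorem stmt15 (g : ℝ) (R : M3) (p : Fin 3 → ℝ) (hR : R ∈ SO3) (he : R *ᵥ e3 = e3)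
    (P : M5) (hP : P ∈ SE23set) (ω a bω ba : Fin 3 → ℝ) :
    (Wmat ω a - Wmat bω ba + Dmat)
        + ((SE23mk R 0 p)⁻¹ * P)⁻¹ * (Gmat g - Dmat) * ((SE23mk R 0 p)⁻¹ * P)
      = (Wmat ω a - Wmat bω ba + Dmat) + P⁻¹ * (Gmat g - Dmat) * P := by
  have h := aux_inv R p hR
  have hc := aux_comm g R p he
  have hu : IsUnit (SE23mk R 0 p).det := Matrix.isUnit_det_of_right_inverse h
  congr 1
  rw [Matrix.mul_inv_rev, Matrix.nonsing_inv_nonsing_inv _ hu]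
  rw [Matrix.mul_assoc P⁻¹, hc, ← Matrix.mul_assoc, Matrix.mul_assoc P⁻¹,
    Matrix.mul_assoc (Gmat g - Dmat), Matrix.mul_nonsing_inv _ hu, Matrix.mul_one]
end
end
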